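/- arXiv:2201.06385 — 2 statements merged into one kernel-verified Lean document; each statement's English description precedes it below -/
import Mathlib

section
/- For a connected weighted graph and any link (i,j), the relative resistance c_ij·ω_ij equals the probability that a random spanning tree contains the link (i,j); that is, c_ij·ω_ij = (Σ_{T ∈ 𝒯, (i,j) ∈ T} c(T)) / (Σ_{T ∈ 𝒯} c(T)), where 𝒯 is the set of all spanning trees of G. -/
open Matrix

variable {V : Type*}

/- The weighted Laplacian matrix of a weighted graph `(V, G, c)`:
`Q i i = ∑_{k ∼ i} c i k`, `Q i j = -c i j` for links `i ∼ j`, and `0` otherwise. -/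
open Classical in
noncomputable def lapMatrix [Fintype V] (G : SimpleGraph V) (c : V → V → ℝ) :
    Matrix V V ℝ :=
  Matrix.of fun i j =>
    if i = j then ∑ k, if G.Adj i k then c i k else 0
    else if G.Adj i j then -c i j else 0

/- The four Penrose equations characterizing the Moore–Penrose pseudoinverse. -/
def IsMoorePenroseInv [Fintype V] (Q Qd : Matrix V V ℝ) : Prop :=
  Q * Qd * Q = Q ∧ Qd * Q * Qd = Qd ∧ (Q * Qd)ᵀ = Q * Qd ∧ (Qd * Q)ᵀ = Qd * Q

/- The effective resistance `ω i j = (e_i - e_j)ᵀ Q† (e_i - e_j)`, computed from a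
pseudoinverse `Qd` of the Laplacian. -/
open Classical in
noncomputable def effRes [Fintype V] (Qd : Matrix V V ℝ) (i j : V) : ℝ :=
  (Pi.single i 1 - Pi.single j 1) ⬝ᵥ Qd *ᵥ (Pi.single i 1 - Pi.single j 1)

/- The weight `c(T)` of a subgraph: the product of the weights of its links. -/
noncomputable def treeWeight (c : V → V → ℝ) (hc : ∀ i j, c i j = c j i)
    (T : SimpleGraph V) : ℝ :=
  ∏ᶠ e ∈ T.edgeSet, Sym2.lift ⟨c, fun a b => hc a b⟩ e

section

open SimpleGraph hiding lapMatrix lapMatrix_mulVec_apply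

/-- `F` is a spanning forest with exactly two components, one containing `i` and one
containing `j`. -/
def IsTwoForest (F : SimpleGraph V) (i j : V) : Prop :=
  F.IsAcyclic ∧ ¬F.Reachable i j ∧ ∀ w, F.Reachable w i ∨ F.Reachable w j

/-- For a tree `T`, the path from `i` to `j` in `T` traverses the link `(u, v)` from `u` to `v`. -/
def Traverses (T : SimpleGraph V) (i j u v : V) : Prop :=
  T.Adj u v ∧ (T.deleteEdges {s(u, v)}).Reachable u i ∧ (T.deleteEdges {s(u, v)}).Reachable v j

theorem SimpleGraph.IsAcyclic.not_reachable_deleteEdges {T : SimpleGraph V} (hT : T.IsAcyclic)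
    {u v : V} (h : T.Adj u v) : ¬(T.deleteEdges {s(u, v)}).Reachable u v :=
  isBridge_iff.1 (isAcyclic_iff_forall_adj_isBridge.1 hT h)

theorem SimpleGraph.Reachable.deleteEdges_or {T : SimpleGraph V} {w u : V} (h : T.Reachable w u)
    (v : V) : (T.deleteEdges {s(u, v)}).Reachable w u ∨
      (T.deleteEdges {s(u, v)}).Reachable w v := by
  obtain ⟨p⟩ := h
  induction p with
  | nil => exact Or.inl (Reachable.refl _)
  | @cons a b u hab p ih =>
    by_cases hs : s(a, b) = s(u, v)
    · rcases Sym2.eq_iff.1 hs with ⟨rfl, rfl⟩ | ⟨rfl, rfl⟩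
      · exact Or.inl (Reachable.refl _)
      · exact Or.inr (Reachable.refl _)
    · have hadj : (T.deleteEdges {s(u, v)}).Adj a b := by simp [hab, hs]
      exact ih.imp hadj.reachable.trans hadj.reachable.trans

theorem IsTwoForest.of_traverses {T : SimpleGraph V} (hT : T.IsTree) {i j u v : V}
    (h : Traverses T i j u v) : IsTwoForest (T.deleteEdges {s(u, v)}) i j := by
  obtain ⟨huv, hi, hj⟩ := h
  refine ⟨hT.isAcyclic.anti (deleteEdges_le _), fun hij => ?_, fun w => ?_⟩
  · exact hT.isAcyclic.not_reachable_deleteEdges huv ((hi.trans hij).trans hj.symm)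
  · exact ((hT.connected w u).deleteEdges_or v).imp (·.trans hi) (·.trans hj)

section Forest

variable {F : SimpleGraph V} {i j u v : V}

theorem IsTwoForest.not_reachable (hF : IsTwoForest F i j) (hu : F.Reachable u i)
    (hv : F.Reachable v j) : ¬F.Reachable u v :=
  fun h => hF.2.1 ((hu.symm.trans h).trans hv)

theorem IsTwoForest.reachable_right_iff (hF : IsTwoForest F i j) :
    F.Reachable u j ↔ ¬F.Reachable u i :=
  ⟨fun hj hi => hF.2.1 (hi.symm.trans hj), fun hi => (hF.2.2 u).resolve_left hi⟩

theorem IsTwoForest.deleteEdges_sup_edge (hF : IsTwoForest F i j) (hu : F.Reachable u i)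
    (hv : F.Reachable v j) : (F ⊔ edge u v).deleteEdges {s(u, v)} = F := by
  rw [deleteEdges_sup, deleteEdges_edge (by simp), sup_bot_eq, deleteEdges_eq_self]
  rw [Set.disjoint_singleton_right, mem_edgeSet]
  exact fun h => hF.not_reachable hu hv h.reachable

theorem IsTwoForest.sup_edge_adj (hF : IsTwoForest F i j) (hu : F.Reachable u i)
    (hv : F.Reachable v j) : (F ⊔ edge u v).Adj u v := by
  have : u ≠ v := by
    rintro rfl
    exact hF.not_reachable hu hv (Reachable.refl _)
  simp [edge_adj, this]

theorem IsTwoForest.sup_edge_isTree (hF : IsTwoForest F i j) (hu : F.Reachable u i)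
    (hv : F.Reachable v j) : (F ⊔ edge u v).IsTree := by
  have huv := (hF.sup_edge_adj hu hv).reachable
  have key : ∀ w, (F ⊔ edge u v).Reachable w u := fun w => by
    rcases hF.2.2 w with h | h
    · exact (h.trans hu.symm).mono le_sup_left
    · exact ((h.trans hv.symm).mono le_sup_left).trans huv.symm
  exact ⟨{ preconnected := fun a b => (key a).trans (key b).symm, nonempty := ⟨u⟩ },
    hF.1.sup_edge_of_not_reachable (hF.not_reachable hu hv)⟩

theorem IsTwoForest.traverses_sup_edge (hF : IsTwoForest F i j) (hu : F.Reachable u i)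
    (hv : F.Reachable v j) : Traverses (F ⊔ edge u v) i j u v := by
  refine ⟨hF.sup_edge_adj hu hv, ?_⟩
  rw [hF.deleteEdges_sup_edge hu hv]
  exact ⟨hu, hv⟩

end Forest

/-- In a tree, the neighbours `v` of `u` from which `w` can be reached without using the link
`(u, v)`: there is exactly one if `w ≠ u`. -/
theorem SimpleGraph.IsTree.existsUnique_adj_reachable_deleteEdges {T : SimpleGraph V}
    (hT : T.IsTree) {u w : V} (h : u ≠ w) :
    ∃! v, T.Adj u v ∧ (T.deleteEdges {s(u, v)}).Reachable v w := by
  classical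
  obtain ⟨p, hp, hpu⟩ := hT.existsUnique_path u w
  have unique : ∀ v, T.Adj u v → (T.deleteEdges {s(u, v)}).Reachable v w → v = p.snd := by
    intro v hv hr
    obtain ⟨q, hq⟩ := hr.exists_isPath
    have hle : T.deleteEdges {s(u, v)} ≤ T := deleteEdges_le _
    have hmem : u ∉ q.support := fun hu =>
      hT.isAcyclic.not_reachable_deleteEdges hv (q.takeUntil u hu).reachable.symm
    have hpath : (Walk.cons hv (q.mapLe hle)).IsPath := by
      rw [Walk.cons_isPath_iff]
      exact ⟨hq.mapLe hle, by simpa using hmem⟩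
    rw [← hpu _ hpath]
    simp
  refine ⟨p.snd, ?_, fun v hv => unique v hv.1 hv.2⟩
  cases p with
  | nil => exact absurd rfl h
  | @cons _ v _ hv q =>
    rw [Walk.snd_cons]
    refine ⟨hv, ?_⟩
    rw [Walk.cons_isPath_iff] at hp
    exact ⟨q.toDeleteEdge _ fun he => hp.2 (q.fst_mem_support_of_mem_edges he)⟩

section Weights

variable (c : V → V → ℝ) (hc : ∀ i j, c i j = c j i)

theorem treeWeight_pos {T : SimpleGraph V} (h : ∀ i j, T.Adj i j → 0 < c i j) :
    0 < treeWeight c hc T := by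
  refine finprod_mem_induction (fun x => 0 < x) one_pos (fun _ _ => mul_pos) ?_
  rintro ⟨a, b⟩ hab
  exact h a b hab

theorem treeWeight_eq_mul_deleteEdges [Finite V] {T : SimpleGraph V} {u v : V} (h : T.Adj u v) :
    treeWeight c hc T = c u v * treeWeight c hc (T.deleteEdges {s(u, v)}) := by
  have : T.edgeSet = insert s(u, v) (T.deleteEdges {s(u, v)}).edgeSet := by
    rw [edgeSet_deleteEdges, Set.insert_sdiff_singleton,
      Set.insert_eq_of_mem ((mem_edgeSet T).2 h)]
  unfold treeWeight
  rw [this, finprod_mem_insert _ (by simp) (Set.toFinite _)]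
  rfl

end Weights

section Kirchhoff

open Classical in
theorem sum_traverses_sub [Fintype V] {G T : SimpleGraph V} (hTG : T ≤ G) (hT : T.IsTree)
    (i j u : V) :
    (∑ v, if G.Adj u v then
      ((if Traverses T i j u v then 1 else 0) - (if Traverses T i j v u then 1 else 0) : ℝ)
        else 0) = (if u = i then 1 else 0) - (if u = j then 1 else 0) := by
  have count : ∀ w, (∑ v, if T.Adj u v ∧ (T.deleteEdges {s(u, v)}).Reachable v w then (1 : ℝ)
      else 0) = 1 - if u = w then 1 else 0 := by
    intro w
    by_cases h : u = w
    · subst h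
      rw [if_pos rfl, sub_self]
      refine Finset.sum_eq_zero fun v _ => if_neg fun hv => ?_
      exact hT.isAcyclic.not_reachable_deleteEdges hv.1 hv.2.symm
    · obtain ⟨v, hv, hu⟩ := hT.existsUnique_adj_reachable_deleteEdges h
      rw [Finset.sum_eq_single v (fun b _ hb => if_neg fun h' => hb (hu b h')) (by simp)]
      simp [hv, h]
  have key : ∀ v, (if G.Adj u v then
      ((if Traverses T i j u v then 1 else 0) - (if Traverses T i j v u then 1 else 0) : ℝ)
        else 0) =
      (if T.Adj u v ∧ (T.deleteEdges {s(u, v)}).Reachable v j then (1 : ℝ) else 0) -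
      (if T.Adj u v ∧ (T.deleteEdges {s(u, v)}).Reachable v i then (1 : ℝ) else 0) := by
    intro v
    by_cases huv : T.Adj u v
    · have hcompl : ∀ w, (T.deleteEdges {s(u, v)}).Reachable u w ↔
          ¬(T.deleteEdges {s(u, v)}).Reachable v w := fun w =>
        ⟨fun h h' => hT.isAcyclic.not_reachable_deleteEdges huv (h.trans h'.symm),
          fun h => (((hT.connected w u).deleteEdges_or v).resolve_right
            fun h' => h h'.symm).symm⟩
      simp only [Traverses, hTG huv, huv, huv.symm, Sym2.eq_swap (a := v) (b := u), hcompl,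
        true_and, if_true]
      split_ifs <;> simp_all
    · have hvu : ¬T.Adj v u := fun h => huv h.symm
      simp [Traverses, huv, hvu]
  simp_rw [key, Finset.sum_sub_distrib, count]
  ring

variable [Fintype V] (G : SimpleGraph V) (c : V → V → ℝ) (hc : ∀ i j, c i j = c j i)

open Classical in
/-- The total weight of the spanning two-component forests separating `i` from `j` in which `u`
lies with `i`. Up to normalization this is the potential at `u` for a unit current from `i`
to `j`. -/
noncomputable def forestPotential (i j u : V) : ℝ :=
  ∑ F : SimpleGraph V with F ≤ G ∧ IsTwoForest F i j,
    treeWeight c hc F * if F.Reachable u i then 1 else 0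

open Classical in
theorem mul_sum_forest_eq_sum_tree {u v : V} (huv : G.Adj u v) (i j : V) :
    (c u v * ∑ F : SimpleGraph V with F ≤ G ∧ IsTwoForest F i j,
      treeWeight c hc F * if F.Reachable u i ∧ F.Reachable v j then 1 else 0) =
    ∑ T : SimpleGraph V with T ≤ G ∧ T.IsTree,
      treeWeight c hc T * if Traverses T i j u v then 1 else 0 := by
  simp_rw [mul_ite, mul_one, mul_zero, ← Finset.sum_filter, Finset.filter_filter,
    Finset.mul_sum]
  refine Finset.sum_bij' (fun F _ => F ⊔ edge u v) (fun T _ => T.deleteEdges {s(u, v)})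
    ?_ ?_ ?_ ?_ ?_
  · simp only [Finset.mem_filter, Finset.mem_univ, true_and]
    rintro F ⟨⟨hFG, hF⟩, hu, hv⟩
    exact ⟨⟨sup_le hFG ((edge_le_iff G).2 (Or.inr huv)), hF.sup_edge_isTree hu hv⟩,
      hF.traverses_sup_edge hu hv⟩
  · simp only [Finset.mem_filter, Finset.mem_univ, true_and]
    rintro T ⟨⟨hTG, hT⟩, h⟩
    exact ⟨⟨(deleteEdges_le _).trans hTG, .of_traverses hT h⟩, h.2⟩
  · simp only [Finset.mem_filter, Finset.mem_univ, true_and]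
    rintro F ⟨⟨-, hF⟩, hu, hv⟩
    exact hF.deleteEdges_sup_edge hu hv
  · simp only [Finset.mem_filter, Finset.mem_univ, true_and]
    rintro T ⟨-, h, -⟩
    ext a b
    simp only [sup_adj, deleteEdges_adj, edge_adj, Set.mem_singleton_iff, Sym2.eq_iff]
    have := h.symm
    have := h.ne
    grind
  · simp only [Finset.mem_filter, Finset.mem_univ, true_and]
    rintro F ⟨⟨-, hF⟩, hu, hv⟩
    rw [treeWeight_eq_mul_deleteEdges c hc (hF.sup_edge_adj hu hv),
      hF.deleteEdges_sup_edge hu hv]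

open Classical in
theorem mul_forestPotential_sub {u v : V} (huv : G.Adj u v) (i j : V) :
    c u v * (forestPotential G c hc i j u - forestPotential G c hc i j v) =
    ∑ T : SimpleGraph V with T ≤ G ∧ T.IsTree, treeWeight c hc T *
      ((if Traverses T i j u v then 1 else 0) - (if Traverses T i j v u then 1 else 0)) := by
  simp_rw [mul_sub, Finset.sum_sub_distrib]
  rw [← mul_sum_forest_eq_sum_tree G c hc huv, ← mul_sum_forest_eq_sum_tree G c hc huv.symm,
    hc v u, ← mul_sub, ← mul_sub, ← Finset.sum_sub_distrib]
  unfold forestPotential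
  rw [← Finset.sum_sub_distrib]
  congr 1
  refine Finset.sum_congr rfl fun F hF => ?_
  have hF' := (Finset.mem_filter.1 hF).2.2
  simp only [hF'.reachable_right_iff]
  by_cases hu : F.Reachable u i <;> by_cases hv : F.Reachable v i <;> simp [hu, hv]

theorem forestPotential_right (i j : V) : forestPotential G c hc i j j = 0 := by
  classical
  refine Finset.sum_eq_zero fun F hF => ?_
  rw [if_neg fun h => (Finset.mem_filter.1 hF).2.2.2.1 h.symm, mul_zero]

open Classical in
theorem mul_forestPotential_left {i j : V} (hij : G.Adj i j) :
    c i j * forestPotential G c hc i j i =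
      ∑ T : SimpleGraph V with T ≤ G ∧ T.IsTree ∧ T.Adj i j, treeWeight c hc T := by
  have h := mul_forestPotential_sub G c hc hij i j
  rw [forestPotential_right, sub_zero] at h
  simp_rw [h, ← and_assoc, ← Finset.filter_filter (fun T : SimpleGraph V => T ≤ G ∧ T.IsTree),
    Finset.sum_filter _ (treeWeight c hc)]
  refine Finset.sum_congr rfl fun T hT => ?_
  have hT' := (Finset.mem_filter.1 hT).2.2
  have hji : ¬Traverses T i j j i := fun h =>
    hT'.isAcyclic.not_reachable_deleteEdges h.1 h.2.1
  rw [if_neg hji]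
  simp [Traverses]

theorem lapMatrix_mulVec_apply (x : V → ℝ) (u : V) :
    (lapMatrix G c *ᵥ x) u = ∑ v, open Classical in
      if G.Adj u v then c u v * (x u - x v) else 0 := by
  classical
  have : ∀ v, lapMatrix G c u v * x v =
      (if u = v then (∑ k, if G.Adj u k then c u k else 0) * x v else 0) -
        if G.Adj u v then c u v * x v else 0 := by
    intro v
    by_cases h : u = v
    · subst h
      simp [lapMatrix]
    · by_cases huv : G.Adj u v <;> simp [lapMatrix, h, huv]
  simp_rw [mulVec, dotProduct, this, Finset.sum_sub_distrib]
  rw [Finset.sum_ite_eq, if_pos (Finset.mem_univ _), Finset.sum_mul, ← Finset.sum_sub_distrib]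
  refine Finset.sum_congr rfl fun v _ => ?_
  split_ifs <;> ring

theorem lapMatrix_transpose {c : V → V → ℝ} (hc : ∀ i j, c i j = c j i) :
    (lapMatrix G c)ᵀ = lapMatrix G c := by
  classical
  ext a b
  by_cases h : a = b
  · subst h
    rfl
  · simp [lapMatrix, h, Ne.symm h, G.adj_comm b a, hc b a]

open Classical in
theorem lapMatrix_mulVec_forestPotential (i j : V) :
    lapMatrix G c *ᵥ forestPotential G c hc i j =
      (∑ T : SimpleGraph V with T ≤ G ∧ T.IsTree, treeWeight c hc T) •
        (Pi.single i 1 - Pi.single j 1) := by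
  ext u
  rw [lapMatrix_mulVec_apply]
  have : ∀ v, (if G.Adj u v then c u v *
      (forestPotential G c hc i j u - forestPotential G c hc i j v) else 0) =
      ∑ T : SimpleGraph V with T ≤ G ∧ T.IsTree, treeWeight c hc T *
        if G.Adj u v then
          ((if Traverses T i j u v then 1 else 0) - (if Traverses T i j v u then 1 else 0))
        else 0 := by
    intro v
    split_ifs with h
    · exact mul_forestPotential_sub G c hc h i j
    · simp
  simp_rw [this]
  rw [Finset.sum_comm]
  simp_rw [← Finset.mul_sum]
  simp only [Pi.smul_apply, Pi.sub_apply, Pi.single_apply, smul_eq_mul, Finset.sum_mul]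
  refine Finset.sum_congr rfl fun T hT => ?_
  obtain ⟨hTG, hT⟩ := (Finset.mem_filter.1 hT).2
  rw [sum_traverses_sub hTG hT]

end Kirchhoff

theorem IsMoorePenroseInv.dotProduct_mulVec [Fintype V] {Q Qd : Matrix V V ℝ}
    (h : IsMoorePenroseInv Q Qd) (hQ : Qᵀ = Q) (x : V → ℝ) :
    (Q *ᵥ x) ⬝ᵥ Qd *ᵥ (Q *ᵥ x) = x ⬝ᵥ Q *ᵥ x := by
  have : Q *ᵥ x = x ᵥ* Q := by rw [← mulVec_transpose, hQ]
  nth_rewrite 1 [this]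
  rw [← Matrix.dotProduct_mulVec, mulVec_mulVec, mulVec_mulVec, h.1]

theorem IsMoorePenroseInv.mul_effRes [Fintype V] {Q Qd : Matrix V V ℝ}
    (h : IsMoorePenroseInv Q Qd) (hQ : Qᵀ = Q) {x : V → ℝ} {t : ℝ} (ht : t ≠ 0) {i j : V}
    (hx : open Classical in Q *ᵥ x = t • (Pi.single i 1 - Pi.single j 1)) :
    t * effRes Qd i j = x i - x j := by
  classical
  have key := h.dotProduct_mulVec hQ x
  rw [hx, mulVec_smul, smul_dotProduct, dotProduct_smul, dotProduct_smul, dotProduct_sub x,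
    dotProduct_single, dotProduct_single, mul_one, mul_one] at key
  exact mul_left_cancel₀ ht key

open Classical in
theorem mul_effRes_eq_div [Fintype V] (G : SimpleGraph V) (c : V → V → ℝ)
    (hc : ∀ i j, c i j = c j i) (hpos : ∀ i j, G.Adj i j → 0 < c i j) (hconn : G.Connected)
    {Qd : Matrix V V ℝ} (hQd : IsMoorePenroseInv (lapMatrix G c) Qd) {i j : V}
    (hij : G.Adj i j) :
    c i j * effRes Qd i j =
      (∑ T : SimpleGraph V with T ≤ G ∧ T.IsTree ∧ T.Adj i j, treeWeight c hc T) /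
        ∑ T : SimpleGraph V with T ≤ G ∧ T.IsTree, treeWeight c hc T := by
  have htrees : 0 < ∑ T : SimpleGraph V with T ≤ G ∧ T.IsTree, treeWeight c hc T := by
    obtain ⟨T, hTG, hT⟩ := hconn.exists_isTree_le
    exact Finset.sum_pos
      (fun T hT => treeWeight_pos c hc fun a b hab =>
        hpos a b ((Finset.mem_filter.1 hT).2.1 hab))
      ⟨T, by simp [hTG, hT]⟩
  have hω := hQd.mul_effRes (lapMatrix_transpose G hc) htrees.ne'
    (lapMatrix_mulVec_forestPotential G c hc i j)
  rw [forestPotential_right, sub_zero] at hω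
  rw [← mul_forestPotential_left G c hc hij, ← hω, eq_div_iff htrees.ne']
  ring

end

/- STATEMENT 1: the relative resistance of a link equals the probability that a
random spanning tree (sampled proportionally to the product of its link weights)
contains that link. -/
theorem relative_resistance_eq_spanning_tree_probability
    [Fintype V] [DecidableEq V] (G : SimpleGraph V) [DecidableRel G.Adj]
    (c : V → V → ℝ) (hsymm : ∀ i j, c i j = c j i)
    (hpos : ∀ i j, G.Adj i j → 0 < c i j)
    (hconn : G.Connected)
    (Qd : Matrix V V ℝ) (hQd : IsMoorePenroseInv (lapMatrix G c) Qd)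
    (i j : V) (hij : G.Adj i j) :
    c i j * effRes Qd i j =
      (∑ᶠ T ∈ {T : SimpleGraph V | T ≤ G ∧ T.IsTree ∧ T.Adj i j}, treeWeight c hsymm T) /
        ∑ᶠ T ∈ {T : SimpleGraph V | T ≤ G ∧ T.IsTree}, treeWeight c hsymm T := by
  rw [mul_effRes_eq_div G c hsymm hpos hconn hQd hij, finsum_mem_eq_finite_toFinset_sum _
    (Set.toFinite _), finsum_mem_eq_finite_toFinset_sum _ (Set.toFinite _)]
  congr 1 <;> exact Finset.sum_congr (by ext; simp) fun _ _ => rfl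
end

section
/- For any node i of a weighted graph with combinatorial degree d_i ≥ 1, the node resistance curvature satisfies 1 − d_i/2 ≤ p_i ≤ 1 − β(G_i∖{i})/2, where G_i is the connected component containing i and G_i∖{i} is that component with node i (and its incident links) removed; equality (in either bound) holds if and only if all links incident to i are cut links, in which case both bounds coincide. In particular, p_i ≤ 1/2. -/
open Matrix

variable {V : Type*}

/- The node resistance curvature `p i = 1 - (1/2) ∑_{j ∼ i} c i j * ω i j`. -/
open Classical in
noncomputable def nodeCurv [Fintype V] (G : SimpleGraph V) (c : V → V → ℝ)
    (Qd : Matrix V V ℝ) (i : V) : ℝ :=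
  1 - 1 / 2 * ∑ j, if G.Adj i j then c i j * effRes Qd i j else 0

/- A link is a cut link (bridge) if its removal increases the number of
connected components of the graph. -/
def IsCutLink (G : SimpleGraph V) (i j : V) : Prop :=
  G.Adj i j ∧
    Nat.card G.ConnectedComponent <
      Nat.card (G.deleteEdges {s(i, j)}).ConnectedComponent

/-- The weight of a link, extended by `0` to pairs of nodes that are not linked. -/
noncomputable def linkWeight (G : SimpleGraph V) (c : V → V → ℝ) (a b : V) : ℝ :=
  open Classical in if G.Adj a b then c a b else 0

/-- The polarized Dirichlet energy of a weighted graph. -/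
noncomputable def energyForm [Fintype V] (G : SimpleGraph V) (c : V → V → ℝ) (f g : V → ℝ) : ℝ :=
  1 / 2 * ∑ a, ∑ b, linkWeight G c a b * ((f a - f b) * (g a - g b))

section Energy

variable {G : SimpleGraph V} {c : V → V → ℝ}

lemma linkWeight_of_adj {a b : V} (h : G.Adj a b) : linkWeight G c a b = c a b := if_pos h

lemma linkWeight_of_not_adj {a b : V} (h : ¬ G.Adj a b) : linkWeight G c a b = 0 := if_neg h

lemma linkWeight_symm (hsymm : ∀ i j, c i j = c j i) (a b : V) :
    linkWeight G c a b = linkWeight G c b a := by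
  classical
  exact if_congr (G.adj_comm a b) (hsymm a b) rfl

lemma linkWeight_nonneg (hpos : ∀ i j, G.Adj i j → 0 < c i j) (a b : V) :
    0 ≤ linkWeight G c a b := by
  by_cases h : G.Adj a b
  · rw [linkWeight_of_adj h]; exact (hpos a b h).le
  · rw [linkWeight_of_not_adj h]

variable [Fintype V]

lemma lapMatrix_isSymm (hsymm : ∀ i j, c i j = c j i) : (lapMatrix G c)ᵀ = lapMatrix G c := by
  classical
  ext a b
  simp only [lapMatrix, transpose_apply, of_apply]
  by_cases h : a = b
  · subst h; rfl
  · rw [if_neg h, if_neg (Ne.symm h)]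
    exact if_congr (G.adj_comm b a) (by rw [hsymm]) rfl

lemma lapMatrix_mulVec (f : V → ℝ) (a : V) :
    (lapMatrix G c *ᵥ f) a = ∑ b, linkWeight G c a b * (f a - f b) := by
  classical
  have h : ∀ b, lapMatrix G c a b * f b =
      (if a = b then (∑ k, linkWeight G c a k) * f a else 0) - linkWeight G c a b * f b := by
    intro b
    by_cases hab : a = b
    · subst hab
      simp [lapMatrix, linkWeight]
    · by_cases hadj : G.Adj a b <;> simp [lapMatrix, linkWeight, hab, hadj]
  simp only [mulVec, dotProduct, h, Finset.sum_sub_distrib, Finset.sum_ite_eq,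
    Finset.mem_univ, if_true, mul_sub, Finset.sum_mul]

lemma dotProduct_lapMatrix_mulVec (hsymm : ∀ i j, c i j = c j i) (f g : V → ℝ) :
    f ⬝ᵥ lapMatrix G c *ᵥ g = energyForm G c f g := by
  have h₁ : f ⬝ᵥ lapMatrix G c *ᵥ g =
      ∑ a, ∑ b, linkWeight G c a b * (f a * (g a - g b)) := by
    simp only [dotProduct, lapMatrix_mulVec, Finset.mul_sum]
    exact Finset.sum_congr rfl fun a _ => Finset.sum_congr rfl fun b _ => by ring
  have h₂ : f ⬝ᵥ lapMatrix G c *ᵥ g =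
      ∑ a, ∑ b, linkWeight G c a b * (f b * (g b - g a)) := by
    rw [h₁, Finset.sum_comm]
    refine Finset.sum_congr rfl fun a _ => Finset.sum_congr rfl fun b _ => ?_
    rw [linkWeight_symm hsymm]
  have h₃ : ∑ a, ∑ b, linkWeight G c a b * ((f a - f b) * (g a - g b)) =
      (∑ a, ∑ b, linkWeight G c a b * (f a * (g a - g b))) +
        ∑ a, ∑ b, linkWeight G c a b * (f b * (g b - g a)) := by
    simp only [← Finset.sum_add_distrib]
    exact Finset.sum_congr rfl fun a _ => Finset.sum_congr rfl fun b _ => by ring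
  rw [energyForm, h₃, ← h₁, ← h₂]
  ring

lemma energyForm_add_smul_left (f g k : V → ℝ) (t : ℝ) :
    energyForm G c (f + t • g) k = energyForm G c f k + t * energyForm G c g k := by
  simp only [energyForm, Finset.mul_sum, ← Finset.sum_add_distrib]
  refine Finset.sum_congr rfl fun a _ => Finset.sum_congr rfl fun b _ => ?_
  simp only [Pi.add_apply, Pi.smul_apply, smul_eq_mul]
  ring

lemma energyForm_comm (f g : V → ℝ) : energyForm G c f g = energyForm G c g f := by
  simp only [energyForm, mul_comm]

lemma energyForm_self_nonneg (hpos : ∀ i j, G.Adj i j → 0 < c i j) (f : V → ℝ) :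
    0 ≤ energyForm G c f f :=
  mul_nonneg (by norm_num) <| Finset.sum_nonneg fun a _ => Finset.sum_nonneg fun b _ =>
    mul_nonneg (linkWeight_nonneg hpos a b) (mul_self_nonneg _)

lemma energyForm_eq_zero_of_const {f : V → ℝ} (hf : ∀ a b, G.Adj a b → f a = f b)
    (g : V → ℝ) : energyForm G c f g = 0 := by
  have h : ∀ a b, linkWeight G c a b * ((f a - f b) * (g a - g b)) = 0 := fun a b => by
    by_cases hab : G.Adj a b
    · rw [hf a b hab]; ring
    · rw [linkWeight_of_not_adj hab, zero_mul]
  simp [energyForm, h]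

lemma eq_of_adj_of_energyForm_self_eq_zero (hpos : ∀ i j, G.Adj i j → 0 < c i j) {f : V → ℝ}
    (hf : energyForm G c f f = 0) {a b : V} (hab : G.Adj a b) : f a = f b := by
  have hterm : ∀ a b, 0 ≤ linkWeight G c a b * ((f a - f b) * (f a - f b)) := fun a b =>
    mul_nonneg (linkWeight_nonneg hpos a b) (mul_self_nonneg _)
  have h₀ : ∑ a, ∑ b, linkWeight G c a b * ((f a - f b) * (f a - f b)) = 0 := by
    rw [energyForm] at hf; linarith
  have h₁ := (Finset.sum_eq_zero_iff_of_nonneg fun a _ =>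
    Finset.sum_nonneg fun b _ => hterm a b).1 h₀ a (Finset.mem_univ a)
  have h₂ := (Finset.sum_eq_zero_iff_of_nonneg fun b _ => hterm a b).1 h₁ b (Finset.mem_univ b)
  rw [linkWeight_of_adj hab] at h₂
  have h₃ := (mul_eq_zero.1 h₂).resolve_left (hpos a b hab).ne'
  exact sub_eq_zero.1 (mul_self_eq_zero.1 h₃)

lemma energyForm_eq_deleteEdges_add (hsymm : ∀ i j, c i j = c j i) {i j : V} (hij : G.Adj i j)
    (f g : V → ℝ) :
    energyForm G c f g = energyForm (G.deleteEdges {s(i, j)}) c f g +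
      c i j * ((f i - f j) * (g i - g j)) := by
  classical
  have hne : i ≠ j := hij.ne
  have h : ∀ a b, linkWeight G c a b * ((f a - f b) * (g a - g b)) =
      linkWeight (G.deleteEdges {s(i, j)}) c a b * ((f a - f b) * (g a - g b)) +
        ((if a = i then if b = j then c i j * ((f i - f j) * (g i - g j)) else 0 else 0) +
          if a = j then if b = i then c i j * ((f i - f j) * (g i - g j)) else 0 else 0) := by
    intro a b
    by_cases h₁ : a = i ∧ b = j
    · obtain ⟨rfl, rfl⟩ := h₁
      simp [linkWeight, hij, hne]
    · by_cases h₂ : a = j ∧ b = i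
      · obtain ⟨rfl, rfl⟩ := h₂
        simp only [linkWeight, SimpleGraph.deleteEdges_adj, hij.symm, hne, hne.symm, hsymm a b,
          Sym2.eq_swap, Set.mem_singleton_iff, not_true_eq_false, and_false, if_true, if_false]
        ring
      · have hdel : (G.deleteEdges {s(i, j)}).Adj a b ↔ G.Adj a b := by
          simp [SimpleGraph.deleteEdges_adj, h₁, h₂]
        simp only [linkWeight, hdel]
        split_ifs <;> simp_all
  simp only [energyForm, h, Finset.sum_add_distrib, Finset.sum_ite_eq', Finset.mem_univ, if_true,
    Finset.sum_const_zero, Finset.sum_ite_irrel]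
  ring

/-- A unit potential: injecting a unit current at `i` and extracting it at `j` produces potentials
`f` whose drop is the effective resistance. -/
lemma exists_potential (hsymm : ∀ i j, c i j = c j i) (hpos : ∀ i j, G.Adj i j → 0 < c i j)
    {Qd : Matrix V V ℝ} (hQd : IsMoorePenroseInv (lapMatrix G c) Qd) {i j : V}
    (hij : G.Adj i j) :
    ∃ f : V → ℝ, (∀ g, energyForm G c g f = g i - g j) ∧ effRes Qd i j = f i - f j := by
  classical
  obtain ⟨hQ, -, hP, -⟩ := hQd
  set Q := lapMatrix G c with hQdef
  have hQs : Qᵀ = Q := lapMatrix_isSymm hsymm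
  have hQP : Q * (Q * Qd) = Q := by
    have := congrArg transpose hQ
    rwa [transpose_mul, hP, hQs] at this
  have hPP : (Q * Qd) * (Q * Qd) = Q * Qd := by rw [← mul_assoc, hQ]
  set u : V → ℝ := Pi.single i 1 - Pi.single j 1 with hu
  have hdot : ∀ g : V → ℝ, g ⬝ᵥ u = g i - g j := fun g => by simp [hu, dotProduct_sub]
  set v : V → ℝ := u - (Q * Qd) *ᵥ u with hv
  have hQv : Q *ᵥ v = 0 := by
    rw [hv, mulVec_sub, mulVec_mulVec, hQP, sub_self]
  have hPv : (Q * Qd) *ᵥ v = 0 := by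
    rw [hv, mulVec_sub, mulVec_mulVec, hPP, sub_self]
  have hvu : v ⬝ᵥ u = 0 := by
    have h₀ : energyForm G c v v = 0 := by
      rw [← dotProduct_lapMatrix_mulVec hsymm, ← hQdef, hQv, dotProduct_zero]
    rw [hdot, eq_of_adj_of_energyForm_self_eq_zero hpos h₀ hij, sub_self]
  have hvPu : v ⬝ᵥ (Q * Qd) *ᵥ u = 0 := by
    rw [dotProduct_mulVec, ← mulVec_transpose, hP, hPv, zero_dotProduct]
  have hv₀ : v = 0 := by
    rw [← dotProduct_self_eq_zero (R := ℝ)]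
    conv_lhs => rw [hv, dotProduct_sub, ← hv, hvu, hvPu, sub_zero]
  have hPu : Q *ᵥ (Qd *ᵥ u) = u := by
    rw [mulVec_mulVec]; exact (sub_eq_zero.1 hv₀).symm
  refine ⟨Qd *ᵥ u, fun g => ?_, ?_⟩
  · rw [← dotProduct_lapMatrix_mulVec hsymm, ← hQdef, hPu, hdot]
  · rw [← hdot, dotProduct_comm]
    simp only [effRes, hu]

end Energy

section CutLink

variable {G : SimpleGraph V} {c : V → V → ℝ} {i j : V}

lemma isCutLink_iff [Finite V] :
    IsCutLink G i j ↔ G.Adj i j ∧ ¬ (G.deleteEdges {s(i, j)}).Reachable i j := by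
  refine and_congr_right fun hij => ?_
  have hle : G.deleteEdges {s(i, j)} ≤ G := G.deleteEdges_le _
  let φ : (G.deleteEdges {s(i, j)}).ConnectedComponent → G.ConnectedComponent :=
    SimpleGraph.ConnectedComponent.map (SimpleGraph.Hom.ofLE hle)
  have hφ : Function.Surjective φ := fun K => by
    induction K using SimpleGraph.ConnectedComponent.ind with
    | h v => exact ⟨SimpleGraph.connectedComponentMk _ v, rfl⟩
  constructor
  · intro hlt hr
    refine hlt.not_ge (Nat.card_le_card_of_injective φ fun K L => ?_)
    induction K using SimpleGraph.ConnectedComponent.ind with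
    | h v =>
    induction L using SimpleGraph.ConnectedComponent.ind with
    | h w =>
    intro h
    obtain ⟨p⟩ : G.Reachable v w := SimpleGraph.ConnectedComponent.exact h
    refine SimpleGraph.ConnectedComponent.sound ?_
    clear h
    induction p with
    | nil => exact .rfl
    | @cons a b d hab p ih =>
      refine SimpleGraph.Reachable.trans ?_ ih
      by_cases he : s(a, b) = s(i, j)
      · rcases Sym2.eq_iff.1 he with ⟨rfl, rfl⟩ | ⟨rfl, rfl⟩
        · exact hr
        · exact hr.symm
      · exact SimpleGraph.Adj.reachable (SimpleGraph.deleteEdges_adj.2 ⟨hab, he⟩)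
  · intro hr
    refine lt_of_le_of_ne (Nat.card_le_card_of_surjective φ hφ) fun h => hr ?_
    have hinj := ((Nat.bijective_iff_surjective_and_card φ).2 ⟨hφ, h.symm⟩).injective
    exact SimpleGraph.ConnectedComponent.exact
      (hinj (SimpleGraph.ConnectedComponent.sound (SimpleGraph.Adj.reachable hij)))

variable [Fintype V]

lemma weight_mul_effRes_le_one (hsymm : ∀ i j, c i j = c j i)
    (hpos : ∀ i j, G.Adj i j → 0 < c i j) {Qd : Matrix V V ℝ}
    (hQd : IsMoorePenroseInv (lapMatrix G c) Qd) (hij : G.Adj i j) :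
    c i j * effRes Qd i j ≤ 1 := by
  obtain ⟨f, hf, hω⟩ := exists_potential hsymm hpos hQd hij
  have h := energyForm_eq_deleteEdges_add hsymm hij f f
  have h₀ := energyForm_self_nonneg (G := G.deleteEdges {s(i, j)})
    (fun a b hab => hpos a b (G.deleteEdges_le _ hab)) f
  rw [hf] at h
  rw [hω]
  by_contra! hlt
  have hc := hpos i j hij
  have hd : 0 < f i - f j := pos_of_mul_pos_right (one_pos.trans hlt) hc.le
  nlinarith

lemma weight_mul_effRes_eq_one_iff (hsymm : ∀ i j, c i j = c j i)
    (hpos : ∀ i j, G.Adj i j → 0 < c i j) {Qd : Matrix V V ℝ}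
    (hQd : IsMoorePenroseInv (lapMatrix G c) Qd) (hij : G.Adj i j) :
    c i j * effRes Qd i j = 1 ↔ IsCutLink G i j := by
  classical
  obtain ⟨f, hf, hω⟩ := exists_potential hsymm hpos hQd hij
  rw [isCutLink_iff, hω]
  constructor
  · refine fun h => ⟨hij, fun ⟨p⟩ => ?_⟩
    have h₀ : energyForm (G.deleteEdges {s(i, j)}) c f f = 0 := by
      have := energyForm_eq_deleteEdges_add hsymm hij f f
      rw [hf, ← mul_assoc, h] at this
      linarith
    have hconst : ∀ {a b}, (G.deleteEdges {s(i, j)}).Walk a b → f a = f b := fun p => by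
      induction p with
      | nil => rfl
      | cons hab _ ih =>
        exact (eq_of_adj_of_energyForm_self_eq_zero
          (fun a b hab => hpos a b (G.deleteEdges_le _ hab)) h₀ hab).trans ih
    rw [hconst p, sub_self, mul_zero] at h
    exact zero_ne_one h
  · rintro ⟨-, hr⟩
    let h : V → ℝ := fun a => if (G.deleteEdges {s(i, j)}).Reachable i a then 1 else 0
    have hh : ∀ a b, (G.deleteEdges {s(i, j)}).Adj a b → h a = h b := fun a b hab =>
      if_congr ⟨fun p => p.trans hab.reachable, fun p => p.trans hab.symm.reachable⟩ rfl rfl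
    have hi : h i = 1 := if_pos .rfl
    have hj : h j = 0 := if_neg hr
    have := energyForm_eq_deleteEdges_add hsymm hij h f
    rw [hf, energyForm_eq_zero_of_const hh, hi, hj] at this
    linarith

end CutLink

/-- The connected component of `i` with the node `i` removed. -/
abbrev puncturedComponent (G : SimpleGraph V) (i : V) :
    SimpleGraph {v | G.Reachable i v ∧ v ≠ i} :=
  G.induce {v | G.Reachable i v ∧ v ≠ i}

/-- The component of `G_i ∖ {i}` to which a neighbor of `i` belongs. -/
def neighborComponent (G : SimpleGraph V) (i : V) (j : G.neighborSet i) :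
    (puncturedComponent G i).ConnectedComponent :=
  (puncturedComponent G i).connectedComponentMk ⟨j, j.2.reachable, j.2.ne'⟩

section Punctured

variable {G : SimpleGraph V} {c : V → V → ℝ} {i : V}

lemma neighborComponent_surjective : Function.Surjective (neighborComponent G i) := by
  intro K
  induction K using SimpleGraph.ConnectedComponent.ind with
  | h v =>
  obtain ⟨v, hv, hvi⟩ := v
  obtain ⟨p⟩ := hv.symm
  induction p with
  | nil => exact absurd rfl hvi
  | @cons a b d hab p ih =>
    by_cases hbd : b = d
    · subst hbd
      exact ⟨⟨a, hab.symm⟩, rfl⟩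
    · obtain ⟨j, hj⟩ := ih p.reachable.symm hbd
      refine ⟨j, hj.trans (SimpleGraph.ConnectedComponent.sound ?_)⟩
      exact SimpleGraph.Adj.reachable (SimpleGraph.induce_adj.2 hab.symm)

lemma neighborComponent_injective_of_isCutLink [Finite V]
    (h : ∀ j, G.Adj i j → IsCutLink G i j) : Function.Injective (neighborComponent G i) := by
  intro j k hjk
  by_contra hne
  refine (isCutLink_iff.1 (h j j.2)).2 ?_
  have hik : (G.deleteEdges {s(i, (j : V))}).Adj i k := by
    refine SimpleGraph.deleteEdges_adj.2 ⟨k.2, fun he => hne ?_⟩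
    exact Subtype.ext (Sym2.congr_right.1 he).symm
  let φ : puncturedComponent G i →g G.deleteEdges {s(i, (j : V))} :=
    { toFun := Subtype.val
      map_rel' := fun {a b} hab => by
        refine SimpleGraph.deleteEdges_adj.2 ⟨hab, fun he => ?_⟩
        rcases Sym2.eq_iff.1 he with ⟨h, -⟩ | ⟨-, h⟩
        · exact a.2.2 h
        · exact b.2.2 h }
  exact hik.reachable.trans ((SimpleGraph.ConnectedComponent.exact hjk).symm.map φ)

variable [Fintype V]

open Classical in
/-- The indicator function, on all nodes, of a component of `G_i ∖ {i}`. -/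
noncomputable def componentIndicator (K : (puncturedComponent G i).ConnectedComponent) (a : V) :
    ℝ :=
  if ∃ ha, (puncturedComponent G i).connectedComponentMk ⟨a, ha⟩ = K then 1 else 0

lemma componentIndicator_self (K : (puncturedComponent G i).ConnectedComponent) :
    componentIndicator K i = 0 :=
  if_neg fun ⟨ha, _⟩ => ha.2 rfl

open Classical in
lemma componentIndicator_neighbor (K : (puncturedComponent G i).ConnectedComponent)
    (j : G.neighborSet i) :
    componentIndicator K j = if neighborComponent G i j = K then 1 else 0 :=
  if_congr ⟨fun ⟨_, h⟩ => h, fun h => ⟨_, h⟩⟩ rfl rfl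

lemma componentIndicator_eq_of_adj (K : (puncturedComponent G i).ConnectedComponent) {a b : V}
    (hab : G.Adj a b) (ha : a ≠ i) (hb : b ≠ i) :
    componentIndicator K a = componentIndicator K b := by
  classical
  have key : ∀ {a b : V}, G.Adj a b → b ≠ i →
      (∃ ha, (puncturedComponent G i).connectedComponentMk ⟨a, ha⟩ = K) →
      ∃ hb, (puncturedComponent G i).connectedComponentMk ⟨b, hb⟩ = K := by
    rintro a b hab hb ⟨ha, rfl⟩
    exact ⟨⟨ha.1.trans hab.reachable, hb⟩, SimpleGraph.ConnectedComponent.sound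
      (SimpleGraph.Adj.reachable (SimpleGraph.induce_adj.2 hab.symm))⟩
  exact if_congr ⟨key hab hb, key hab.symm ha⟩ rfl rfl

open Classical in
lemma energyForm_componentIndicator (hsymm : ∀ i j, c i j = c j i)
    (K : (puncturedComponent G i).ConnectedComponent) (g : V → ℝ) :
    energyForm G c (componentIndicator K) g =
      ∑ j : G.neighborSet i, if neighborComponent G i j = K then c i j * (g j - g i) else 0 := by
  set h : V → ℝ := componentIndicator K with hh
  have hi : h i = 0 := componentIndicator_self K
  have hterm : ∀ a b, linkWeight G c a b * ((h a - h b) * (g a - g b)) =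
      (if a = i then linkWeight G c i b * (h b * (g b - g i)) else 0) +
        if b = i then linkWeight G c i a * (h a * (g a - g i)) else 0 := by
    intro a b
    by_cases ha : a = i
    · subst ha
      by_cases hb : b = a
      · subst hb; simp
      · simp only [hi, hb, if_true, if_false]; ring
    · by_cases hb : b = i
      · subst hb
        simp only [hi, ha, if_true, if_false, linkWeight_symm hsymm b a]; ring
      · by_cases hab : G.Adj a b
        · rw [hh, componentIndicator_eq_of_adj K hab ha hb]; simp [ha, hb]
        · rw [linkWeight_of_not_adj hab]; simp [ha, hb]
  have hsum : energyForm G c h g = ∑ b, linkWeight G c i b * (h b * (g b - g i)) := by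
    simp only [energyForm, hterm, Finset.sum_add_distrib, Finset.sum_ite_eq', Finset.mem_univ,
      if_true, Finset.sum_ite_irrel, Finset.sum_const_zero]
    ring
  rw [hsum, ← Finset.sum_subset (Finset.subset_univ (G.neighborFinset i)) fun b _ hb => by
      rw [linkWeight_of_not_adj (by simpa using hb), zero_mul],
    ← Finset.sum_coe_sort]
  refine Fintype.sum_equiv (Equiv.subtypeEquivRight fun b => by simp) _ _ fun j => ?_
  obtain ⟨j, hj⟩ := j
  have hij : G.Adj i j := by simpa using hj
  have := componentIndicator_neighbor K ⟨j, hij⟩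
  simp only [linkWeight_of_adj hij, hh, Equiv.subtypeEquivRight_apply_coe] at this ⊢
  rw [this]
  split_ifs with h₁ h₂ h₂
  · ring
  · exact absurd h₁ h₂
  · exact absurd h₂ h₁
  · ring

open Classical in
/-- The total weight of the links between `i` and a component of `G_i ∖ {i}`. -/
noncomputable def boundaryWeight (c : V → V → ℝ)
    (K : (puncturedComponent G i).ConnectedComponent) : ℝ :=
  ∑ j : G.neighborSet i, if neighborComponent G i j = K then c i j else 0

lemma boundaryWeight_pos (hpos : ∀ i j, G.Adj i j → 0 < c i j)
    (K : (puncturedComponent G i).ConnectedComponent) : 0 < boundaryWeight c K := by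
  classical
  obtain ⟨j, hj⟩ := neighborComponent_surjective K
  refine Finset.sum_pos' (fun k _ => ?_) ⟨j, Finset.mem_univ j, ?_⟩
  · split_ifs
    exacts [(hpos i k k.2).le, le_rfl]
  · rw [if_pos hj]; exact hpos i j j.2

lemma sum_weight_div_boundaryWeight (hpos : ∀ i j, G.Adj i j → 0 < c i j)
    [Fintype (G.neighborSet i)] :
    ∑ j : G.neighborSet i, c i j / boundaryWeight c (neighborComponent G i j) =
      Nat.card (puncturedComponent G i).ConnectedComponent := by
  classical
  have := Fintype.ofFinite (puncturedComponent G i).ConnectedComponent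
  rw [← Finset.sum_fiberwise Finset.univ (neighborComponent G i)]
  have h : ∀ K : (puncturedComponent G i).ConnectedComponent,
      ∑ j : G.neighborSet i with neighborComponent G i j = K,
        c i j / boundaryWeight c (neighborComponent G i j) = 1 := fun K => by
    rw [Finset.sum_congr rfl fun j hj => by rw [(Finset.mem_filter.1 hj).2],
      ← Finset.sum_div, Finset.sum_filter]
    convert div_self (boundaryWeight_pos hpos K).ne'
    rw [boundaryWeight]
    congr!
  simp [h]

/-- The energy of the unit potential corrected by the indicator of the component of `j`. -/
lemma energyForm_potential_add_componentIndicator (hsymm : ∀ i j, c i j = c j i)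
    (hpos : ∀ i j, G.Adj i j → 0 < c i j) (j : G.neighborSet i) {f : V → ℝ}
    (hf : ∀ g, energyForm G c g f = g i - g j) :
    let K := neighborComponent G i j
    let x := f + (boundaryWeight c K)⁻¹ • componentIndicator K
    energyForm G c x x = f i - f j - (boundaryWeight c K)⁻¹ := by
  classical
  intro K x
  have hC := boundaryWeight_pos hpos K
  have hhh : energyForm G c (componentIndicator K) (componentIndicator K) =
      boundaryWeight c K := by
    rw [energyForm_componentIndicator hsymm, boundaryWeight]
    refine Finset.sum_congr rfl fun k _ => ?_
    rw [componentIndicator_neighbor, componentIndicator_self]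
    split_ifs <;> simp
  have hhf : energyForm G c (componentIndicator K) f = -1 := by
    rw [hf, componentIndicator_self, componentIndicator_neighbor, if_pos rfl, zero_sub]
  rw [energyForm_add_smul_left, energyForm_comm f, energyForm_comm _ x,
    energyForm_add_smul_left, energyForm_add_smul_left, hf, hhf, energyForm_comm f, hhf, hhh,
    inv_mul_cancel₀ hC.ne']
  ring

lemma inv_boundaryWeight_le_effRes (hsymm : ∀ i j, c i j = c j i)
    (hpos : ∀ i j, G.Adj i j → 0 < c i j) {Qd : Matrix V V ℝ}
    (hQd : IsMoorePenroseInv (lapMatrix G c) Qd) (j : G.neighborSet i) :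
    (boundaryWeight c (neighborComponent G i j))⁻¹ ≤ effRes Qd i j := by
  obtain ⟨f, hf, hω⟩ := exists_potential hsymm hpos hQd j.2
  have h := energyForm_potential_add_componentIndicator hsymm hpos j hf
  rw [hω, ← sub_nonneg, ← h]
  exact energyForm_self_nonneg hpos _

lemma inv_boundaryWeight_lt_effRes (hsymm : ∀ i j, c i j = c j i)
    (hpos : ∀ i j, G.Adj i j → 0 < c i j) {Qd : Matrix V V ℝ}
    (hQd : IsMoorePenroseInv (lapMatrix G c) Qd) {j k : G.neighborSet i} (hjk : j ≠ k)
    (hK : neighborComponent G i j = neighborComponent G i k) :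
    (boundaryWeight c (neighborComponent G i j))⁻¹ < effRes Qd i j := by
  classical
  obtain ⟨f, hf, hω⟩ := exists_potential hsymm hpos hQd j.2
  have h := energyForm_potential_add_componentIndicator hsymm hpos j hf
  refine lt_of_le_of_ne (inv_boundaryWeight_le_effRes hsymm hpos hQd j) fun he => ?_
  simp only [← hω, he, sub_self] at h
  have hki : (k : V) ≠ i := k.2.ne'
  have hkj : (k : V) ≠ j := fun h => hjk (Subtype.ext h.symm)
  have h₀ := energyForm_eq_zero_of_const (c := c)
    (fun a b => eq_of_adj_of_energyForm_self_eq_zero hpos h) (Pi.single (k : V) 1)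
  have hhk : energyForm G c (componentIndicator (neighborComponent G i j))
      (Pi.single (k : V) 1) = c i k := by
    rw [energyForm_componentIndicator hsymm, Finset.sum_eq_single k]
    · simp [hK, hki.symm]
    · intro l _ hlk
      have : (l : V) ≠ k := fun h => hlk (Subtype.ext h)
      simp [this, hki.symm]
    · simp
  rw [← he, energyForm_add_smul_left, energyForm_comm f, hf, hhk] at h₀
  simp only [Pi.single_eq_of_ne hki.symm, Pi.single_eq_of_ne hkj.symm, sub_self, zero_add] at h₀
  exact (mul_pos (inv_pos.2 (boundaryWeight_pos hpos _)) (hpos i k k.2)).ne' h₀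

end Punctured

lemma nodeCurv_eq [Fintype V] (G : SimpleGraph V) (c : V → V → ℝ) (Qd : Matrix V V ℝ) (i : V)
    [Fintype (G.neighborSet i)] :
    nodeCurv G c Qd i = 1 - (∑ j : G.neighborSet i, c i j * effRes Qd i j) / 2 := by
  classical
  rw [nodeCurv, ← Finset.sum_filter,
    Finset.sum_subtype _ (p := (· ∈ G.neighborSet i)) (fun j => by simp)]
  ring

/- STATEMENT 7: bounds `1 - d_i/2 ≤ p_i ≤ 1 - β(G_i∖{i})/2` for the node resistance
curvature of a node of degree at least 1, each attained iff all links incident to `i`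
are cut links (in which case the two bounds coincide); in particular `p_i ≤ 1/2`. -/
theorem nodeCurv_bounds
    [Fintype V] [DecidableEq V] (G : SimpleGraph V) [DecidableRel G.Adj]
    (c : V → V → ℝ) (hsymm : ∀ i j, c i j = c j i)
    (hpos : ∀ i j, G.Adj i j → 0 < c i j)
    (Qd : Matrix V V ℝ) (hQd : IsMoorePenroseInv (lapMatrix G c) Qd)
    (i : V) (hd : 1 ≤ G.degree i) :
    (1 - (G.degree i : ℝ) / 2 ≤ nodeCurv G c Qd i) ∧
    (nodeCurv G c Qd i ≤ 1 - (Nat.card (SimpleGraph.induce {v | G.Reachable i v ∧ v ≠ i} G).ConnectedComponent : ℝ) / 2) ∧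
    ((nodeCurv G c Qd i = 1 - (G.degree i : ℝ) / 2) ↔
      ∀ j, G.Adj i j → IsCutLink G i j) ∧
    ((nodeCurv G c Qd i = 1 - (Nat.card (SimpleGraph.induce {v | G.Reachable i v ∧ v ≠ i} G).ConnectedComponent : ℝ) / 2) ↔
      ∀ j, G.Adj i j → IsCutLink G i j) ∧
    ((∀ j, G.Adj i j → IsCutLink G i j) →
      (G.degree i : ℝ) = (Nat.card (SimpleGraph.induce {v | G.Reachable i v ∧ v ≠ i} G).ConnectedComponent : ℝ)) ∧
    nodeCurv G c Qd i ≤ 1 / 2 := by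
  have hbound (j : G.neighborSet i) : c i j * effRes Qd i j ≤ 1 :=
    weight_mul_effRes_le_one hsymm hpos hQd j.2
  have hone (j : G.neighborSet i) : c i j * effRes Qd i j = 1 ↔ IsCutLink G i j :=
    weight_mul_effRes_eq_one_iff hsymm hpos hQd j.2
  have hdiv (j : G.neighborSet i) :
      c i j / boundaryWeight c (neighborComponent G i j) ≤ c i j * effRes Qd i j := by
    rw [div_eq_mul_inv]
    exact mul_le_mul_of_nonneg_left (inv_boundaryWeight_le_effRes hsymm hpos hQd j)
      (hpos i j j.2).le
  have hβ := sum_weight_div_boundaryWeight (i := i) hpos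
  have hdeg : ∑ _j : G.neighborSet i, (1 : ℝ) = G.degree i := by
    rw [Finset.sum_const, nsmul_one, Finset.card_univ, G.card_neighborSet_eq_degree]
  have hle_deg : ∑ j : G.neighborSet i, c i j * effRes Qd i j ≤ G.degree i :=
    hdeg ▸ Finset.sum_le_sum fun j _ => hbound j
  have hβ_le : (Nat.card (puncturedComponent G i).ConnectedComponent : ℝ) ≤
      ∑ j : G.neighborSet i, c i j * effRes Qd i j :=
    hβ ▸ Finset.sum_le_sum fun j _ => hdiv j
  have heq_deg : ∑ j : G.neighborSet i, c i j * effRes Qd i j = G.degree i ↔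
      ∀ j, G.Adj i j → IsCutLink G i j := by
    rw [← hdeg, Finset.sum_eq_sum_iff_of_le fun j _ => hbound j]
    exact ⟨fun h j hij => (hone ⟨j, hij⟩).1 (h _ (Finset.mem_univ _)),
      fun h j _ => (hone j).2 (h j j.2)⟩
  have hcard (hinj : Function.Injective (neighborComponent G i)) :
      (G.degree i : ℝ) = Nat.card (puncturedComponent G i).ConnectedComponent := by
    rw [← Nat.card_eq_of_bijective _ ⟨hinj, neighborComponent_surjective⟩,
      Nat.card_eq_fintype_card, G.card_neighborSet_eq_degree]
  have hcut (h : ∀ j, G.Adj i j → IsCutLink G i j) :=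
    hcard (neighborComponent_injective_of_isCutLink h)
  have heq_β : ∑ j : G.neighborSet i, c i j * effRes Qd i j =
      Nat.card (puncturedComponent G i).ConnectedComponent ↔
        ∀ j, G.Adj i j → IsCutLink G i j := by
    refine ⟨fun h => heq_deg.1 (h.trans (hcard fun j k hjk => ?_).symm),
      fun h => (heq_deg.2 h).trans (hcut h)⟩
    by_contra hne
    refine (hβ ▸ Finset.sum_lt_sum (fun j _ => hdiv j) ⟨j, Finset.mem_univ j, ?_⟩ :
      (Nat.card (puncturedComponent G i).ConnectedComponent : ℝ) <
        ∑ j : G.neighborSet i, c i j * effRes Qd i j).ne' h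
    rw [div_eq_mul_inv]
    exact mul_lt_mul_of_pos_left (inv_boundaryWeight_lt_effRes hsymm hpos hQd hne hjk)
      (hpos i j j.2)
  have hβ_pos : (1 : ℝ) ≤ Nat.card (puncturedComponent G i).ConnectedComponent := by
    obtain ⟨j, hj⟩ := (G.degree_pos_iff_exists_adj i).1 hd
    have : Nonempty (puncturedComponent G i).ConnectedComponent :=
      ⟨neighborComponent G i ⟨j, hj⟩⟩
    exact_mod_cast Nat.card_pos
  rw [nodeCurv_eq]
  refine ⟨by linarith, by linarith, ?_, ?_, hcut, by linarith⟩
  · rw [← heq_deg]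
    constructor <;> intro h <;> linarith
  · rw [← heq_β]
    constructor <;> intro h <;> linarith
end
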